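/- arXiv:1708.03256 — 2 statements merged into one kernel-verified Lean document; each statement's English description precedes it below -/
import Mathlib

section
/- Let n ≥ 1 be an integer, m' ∈ ℝ, and g : ℝⁿ → ℂ a measurable function. Then the following are equivalent: (i) there exists α ∈ RO with σ₀(α) > m' and ∫_{ℝⁿ} α(⟨ξ⟩)²|g(ξ)|² dξ < ∞; (ii) there exists a real number s > m' with ∫_{ℝⁿ} ⟨ξ⟩^{2s}|g(ξ)|² dξ < ∞. (This expresses the equality ⋃{H^{α}(ℝⁿ) : α ∈ RO, σ₀(α) > m'} = ⋃{H^{(s)}(ℝⁿ) : s > m'}.) -/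
noncomputable section

/-- The class RO of Avakumović. -/
def RO (α : ℝ → ℝ) : Prop :=
  Measurable ((Set.Ici (1:ℝ)).restrict α) ∧ (∀ t, 1 ≤ t → 0 < α t) ∧
    ∃ b : ℝ, 1 < b ∧ ∃ c : ℝ, 1 ≤ c ∧
      ∀ t, 1 ≤ t → ∀ l, 1 ≤ l → l ≤ b →
        c⁻¹ ≤ α (l * t) / α t ∧ α (l * t) / α t ≤ c

/-- Exponents `s₀` admissible in the lower power bound for `α`. -/
def S0 (α : ℝ → ℝ) : Set ℝ :=
  {s | ∃ c : ℝ, 0 < c ∧ ∀ t, 1 ≤ t → ∀ l, 1 ≤ l → c * l ^ s ≤ α (l * t) / α t}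

/-- The lower Matuszewska index `σ₀(α) := sup S₀(α)`. -/
def sigma0 (α : ℝ → ℝ) : ℝ := sSup (S0 α)

open MeasureTheory

/-- The smoothed modulus `⟨ξ⟩ = (1 + |ξ|²)^{1/2}`. -/
def smod {n : ℕ} (ξ : EuclideanSpace ℝ (Fin n)) : ℝ := Real.sqrt (1 + ‖ξ‖ ^ 2)

lemma one_le_smod {n : ℕ} (ξ : EuclideanSpace ℝ (Fin n)) : 1 ≤ smod ξ :=
  Real.one_le_sqrt.2 (by nlinarith [sq_nonneg ‖ξ‖])

/-- Every function of class RO admits some lower power bound. -/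
lemma RO.S0_nonempty {α : ℝ → ℝ} (h : RO α) : (S0 α).Nonempty := by
  obtain ⟨-, hpos, b, hb, c, hc, hbc⟩ := h
  have hb0 : 0 < b := by linarith
  have hc0 : 0 < c := by linarith
  have hlogb : 0 < Real.log b := Real.log_pos hb
  set s : ℝ := -(Real.log c / Real.log b) with hs
  have hs0 : s ≤ 0 := neg_nonpos.2 (div_nonneg (Real.log_nonneg hc) hlogb.le)
  have hbs : b ^ s = c⁻¹ := by
    rw [Real.rpow_def_of_pos hb0, hs, mul_neg, mul_div_cancel₀ _ hlogb.ne', Real.exp_neg,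
      Real.exp_log hc0]
  refine ⟨s, c⁻¹, inv_pos.2 hc0, fun t ht l hl => ?_⟩
  have key : ∀ k : ℕ, ∀ l, 1 ≤ l → l ≤ b ^ (k + 1) → c⁻¹ * l ^ s ≤ α (l * t) / α t := by
    intro k
    induction k with
    | zero =>
      intro l hl hlb
      refine le_trans ?_ (hbc t ht l hl (by simpa using hlb)).1
      exact mul_le_of_le_one_right (inv_pos.2 hc0).le (Real.rpow_le_one_of_one_le_of_nonpos hl hs0)
    | succ k ih =>
      intro l hl hlb
      rcases le_total l b with hle | hle
      · refine le_trans ?_ (hbc t ht l hl hle).1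
        exact mul_le_of_le_one_right (inv_pos.2 hc0).le
          (Real.rpow_le_one_of_one_le_of_nonpos hl hs0)
      · have h1 : 1 ≤ l / b := (one_le_div hb0).2 hle
        have h2 : l / b ≤ b ^ (k + 1) := (div_le_iff₀ hb0).2 (by rwa [← pow_succ])
        have h3 := ih (l / b) h1 h2
        have hm : 1 ≤ l / b * t := one_le_mul_of_one_le_of_one_le h1 ht
        have h4 := (hbc (l / b * t) hm b hb.le le_rfl).1
        have hl' : b * (l / b) = l := mul_div_cancel₀ _ hb0.ne'
        have hlt : b * (l / b * t) = l * t := by rw [← mul_assoc, hl']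
        rw [hlt] at h4
        calc c⁻¹ * l ^ s = c⁻¹ * (c⁻¹ * (l / b) ^ s) := by
              rw [← hbs, mul_right_inj' (Real.rpow_pos_of_pos hb0 s).ne', ← Real.mul_rpow hb0.le (zero_le_one.trans h1), hl']
          _ ≤ α (l * t) / α (l / b * t) * (α (l / b * t) / α t) :=
              mul_le_mul h4 h3 (by positivity) ((inv_pos.2 hc0).le.trans h4)
          _ = α (l * t) / α t := div_mul_div_cancel₀ (hpos _ hm).ne'
  obtain ⟨k, hk⟩ := pow_unbounded_of_one_lt l hb
  exact key k l hl (hk.le.trans (pow_le_pow_right₀ hb.le k.le_succ))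

lemma rpow_mul_div_rpow (s : ℝ) {t l : ℝ} (ht : 1 ≤ t) (hl : 1 ≤ l) :
    (l * t) ^ s / t ^ s = l ^ s := by
  rw [Real.mul_rpow (by linarith) (by linarith),
    mul_div_cancel_right₀ _ (Real.rpow_pos_of_pos (by linarith) s).ne']

lemma RO_rpow (s : ℝ) : RO (fun t => t ^ s) := by
  refine ⟨?_, fun t ht => Real.rpow_pos_of_pos (by linarith) s, 2, one_lt_two, 2 ^ |s|,
    Real.one_le_rpow one_le_two (abs_nonneg s), fun t ht l hl hl2 => ?_⟩
  · exact (measurable_id.pow_const s).comp measurable_subtype_coe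
  · simp only [rpow_mul_div_rpow s ht hl]
    have hl0 : 0 ≤ l := by linarith
    have habs : l ^ |s| ≤ 2 ^ |s| := Real.rpow_le_rpow hl0 hl2 (abs_nonneg s)
    constructor
    · calc ((2 : ℝ) ^ |s|)⁻¹ ≤ (l ^ |s|)⁻¹ := by gcongr
        _ = l ^ (-|s|) := (Real.rpow_neg hl0 _).symm
        _ ≤ l ^ s := Real.rpow_le_rpow_of_exponent_le hl (neg_abs_le s)
    · exact (Real.rpow_le_rpow_of_exponent_le hl (le_abs_self s)).trans habs

lemma sigma0_rpow (s : ℝ) : sigma0 (fun t => t ^ s) = s := by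
  refine IsGreatest.csSup_eq ⟨⟨1, one_pos, fun t ht l hl => ?_⟩, ?_⟩
  · simp only [rpow_mul_div_rpow s ht hl, one_mul, le_refl]
  · rintro r ⟨c, hc, h⟩
    by_contra! hr
    have hlim := tendsto_rpow_neg_atTop (sub_pos.2 hr)
    obtain ⟨l, hlc, hl⟩ :=
      ((hlim.eventually_lt_const hc).and (Filter.eventually_ge_atTop (1 : ℝ))).exists
    have hle := h 1 le_rfl l hl
    simp only [rpow_mul_div_rpow s le_rfl hl] at hle
    have hl0 : 0 < l := by linarith
    rw [neg_sub, Real.rpow_sub hl0, div_lt_iff₀ (Real.rpow_pos_of_pos hl0 r)] at hlc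
    exact hle.not_gt hlc

/-- `⋃ {H^α(ℝⁿ) : α ∈ RO, σ₀(α) > m'} = ⋃ {H^{(s)}(ℝⁿ) : s > m'}`: a measurable `g` is the
Fourier transform of an element of some `H^α` with `σ₀(α) > m'` iff it is that of an
element of some Sobolev space `H^{(s)}` with `s > m'`. -/
theorem union_hormander_eq_union_sobolev (n : ℕ) (hn : 1 ≤ n) (m' : ℝ)
    (g : EuclideanSpace ℝ (Fin n) → ℂ) (hg : Measurable g) :
    (∃ α : ℝ → ℝ, RO α ∧ m' < sigma0 α ∧
        (∫⁻ ξ, ENNReal.ofReal (α (smod ξ) ^ 2 * ‖g ξ‖ ^ 2)) < ⊤) ↔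
    (∃ s : ℝ, m' < s ∧
        (∫⁻ ξ, ENNReal.ofReal (smod ξ ^ (2 * s) * ‖g ξ‖ ^ 2)) < ⊤) := by
  constructor
  · rintro ⟨α, hα, hm, hint⟩
    obtain ⟨s, ⟨c, hc, hs⟩, hms⟩ := exists_lt_of_lt_csSup hα.S0_nonempty hm
    refine ⟨s, hms, ?_⟩
    have h1 : 0 < α 1 := hα.2.1 1 le_rfl
    have hca : 0 < c * α 1 := mul_pos hc h1
    refine (lintegral_mono (g := fun ξ => ENNReal.ofReal ((c * α 1)⁻¹ ^ 2) *
      ENNReal.ofReal (α (smod ξ) ^ 2 * ‖g ξ‖ ^ 2)) fun ξ => ?_).trans_lt ?_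
    · dsimp only
      rw [← ENNReal.ofReal_mul (by positivity)]
      refine ENNReal.ofReal_le_ofReal ?_
      rw [← mul_assoc, ← mul_pow]
      refine mul_le_mul_of_nonneg_right ?_ (sq_nonneg _)
      have hξ := one_le_smod ξ
      have hb := hs 1 le_rfl _ hξ
      rw [mul_one, le_div_iff₀ h1] at hb
      rw [mul_comm 2 s, Real.rpow_mul (by linarith), Real.rpow_two]
      refine pow_le_pow_left₀ (Real.rpow_nonneg (by linarith) s) ?_ 2
      rw [inv_mul_eq_div, le_div_iff₀ hca]
      linarith
    · rw [lintegral_const_mul' _ _ ENNReal.ofReal_ne_top]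
      exact ENNReal.mul_lt_top ENNReal.ofReal_lt_top hint
  · rintro ⟨s, hms, hint⟩
    refine ⟨fun t => t ^ s, RO_rpow s, by rwa [sigma0_rpow], ?_⟩
    convert hint using 6 with ξ
    rw [mul_comm 2 s, Real.rpow_mul (by linarith [one_le_smod ξ]), Real.rpow_two]
end
end

section
/- (Special Green formula for the problem Δu = f in the unit disk, ∂ν²u = g on the unit circle.) Let u, v : ℝ² → ℂ be infinitely differentiable and let w, h : ℝ → ℂ be infinitely differentiable and 2π-periodic. Then ∫_{B} Δu·conj(v) dx + ∫₀^{2π} Δu(γ(φ))·conj(w(φ)) dφ + ∫₀^{2π} ∂ν²u(γ(φ))·conj(h(φ)) dφ = ∫_{B} u·conj(Δv) dx + ∫₀^{2π} u(γ(φ))·conj( ∂ν v(γ(φ)) + w''(φ) ) dφ + ∫₀^{2π} ∂ν u(γ(φ))·conj( −v(γ(φ)) − w(φ) ) dφ + ∫₀^{2π} ∂ν²u(γ(φ))·conj( w(φ) + h(φ) ) dφ, where B is the open unit ball in ℝ². -/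
noncomputable section

open Real MeasureTheory ComplexConjugate

/-- The Euclidean plane. -/
abbrev Plane := EuclideanSpace ℝ (Fin 2)

/-- The boundary point `γ(φ) = (cos φ, sin φ)` of the unit disk. -/
def gam (φ : ℝ) : Plane := (WithLp.equiv 2 (Fin 2 → ℝ)).symm ![Real.cos φ, Real.sin φ]

/-- The Laplacian `Δf = ∑ᵢ ∂²f/∂xᵢ²`. -/
def lap (f : Plane → ℂ) (x : Plane) : ℂ :=
  ∑ i : Fin 2, fderiv ℝ (fun y => fderiv ℝ f y (EuclideanSpace.single i 1)) x
    (EuclideanSpace.single i 1)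

/-- The inward normal derivative `∂ν f(γ(φ)) = −(d/dr) f(r·γ(φ)) |_{r=1}`. -/
def nder (f : Plane → ℂ) (φ : ℝ) : ℂ := -deriv (fun r : ℝ => f (r • gam φ)) 1

/-- The second inward normal derivative `∂ν² f(γ(φ)) = (d²/dr²) f(r·γ(φ)) |_{r=1}`. -/
def nder2 (f : Plane → ℂ) (φ : ℝ) : ℂ :=
  deriv (deriv (fun r : ℝ => f (r • gam φ))) 1

/-- The partial derivative of `f` in the `i`-th coordinate direction. -/
def partialDeriv (f : Plane → ℂ) (i : Fin 2) (x : Plane) : ℂ :=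
  fderiv ℝ f x (EuclideanSpace.single i 1)

lemma lap_eq_partialDeriv (f : Plane → ℂ) (x : Plane) :
    lap f x = partialDeriv (partialDeriv f 0) 0 x + partialDeriv (partialDeriv f 1) 1 x := by
  simp only [lap, Fin.sum_univ_two]
  rfl

lemma contDiff_partialDeriv {f : Plane → ℂ} {m n : WithTop ℕ∞} (hf : ContDiff ℝ n f)
    (hmn : m + 1 ≤ n) (i : Fin 2) : ContDiff ℝ m (partialDeriv f i) :=
  (hf.fderiv_right hmn).clm_apply contDiff_const

lemma contDiff_gam {n : WithTop ℕ∞} : ContDiff ℝ n gam := by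
  refine (contDiff_euclidean).2 fun i => ?_
  fin_cases i
  · exact Real.contDiff_cos
  · exact Real.contDiff_sin

lemma gam_periodic : Function.Periodic gam (2 * π) := fun φ => by
  simp [gam]

lemma smul_gam (r φ : ℝ) : r • gam φ = !₂[r * Real.cos φ, r * Real.sin φ] := by
  ext i
  fin_cases i <;> simp [gam]

lemma hasDerivAt_comp_plane {f : Plane → ℂ} {c : ℝ → Plane} {a b t : ℝ}
    (hf : DifferentiableAt ℝ f (c t)) (ha : HasDerivAt (fun s => c s 0) a t)
    (hb : HasDerivAt (fun s => c s 1) b t) :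
    HasDerivAt (fun s => f (c s))
      (a * partialDeriv f 0 (c t) + b * partialDeriv f 1 (c t)) t := by
  have hc : HasDerivAt c (a • EuclideanSpace.single 0 1 + b • EuclideanSpace.single 1 1) t := by
    have hc' : HasDerivAt (fun s => (c s).ofLp) ![a, b] t :=
      hasDerivAt_pi.2 fun i => by fin_cases i <;> simpa
    have h := (PiLp.hasFDerivAt_toLp (𝕜 := ℝ) 2 (c t).ofLp).comp_hasDerivAt t hc'
    refine h.congr_deriv ?_
    ext i
    fin_cases i <;> simp
  simpa [partialDeriv] using! hf.hasFDerivAt.comp_hasDerivAt t hc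

lemma hasDerivAt_radial {f : Plane → ℂ} (hf : Differentiable ℝ f) (r φ : ℝ) :
    HasDerivAt (fun s : ℝ => f (s • gam φ))
      (Real.cos φ * partialDeriv f 0 (r • gam φ) + Real.sin φ * partialDeriv f 1 (r • gam φ))
      r := by
  refine hasDerivAt_comp_plane (hf _) ?_ ?_
  · simpa [smul_gam] using (hasDerivAt_id r).mul_const (Real.cos φ)
  · simpa [smul_gam] using (hasDerivAt_id r).mul_const (Real.sin φ)

lemma hasDerivAt_angular {f : Plane → ℂ} (hf : Differentiable ℝ f) (r φ : ℝ) :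
    HasDerivAt (fun θ : ℝ => f (r • gam θ))
      (r * (-Real.sin φ * partialDeriv f 0 (r • gam φ)
        + Real.cos φ * partialDeriv f 1 (r • gam φ))) φ := by
  refine (hasDerivAt_comp_plane (c := fun θ => r • gam θ) (a := r * -Real.sin φ)
    (b := r * Real.cos φ) (hf _) ?_ ?_).congr_deriv ?_
  · simpa [smul_gam] using (Real.hasDerivAt_cos φ).const_mul r
  · simpa [smul_gam] using (Real.hasDerivAt_sin φ).const_mul r
  · push_cast
    ring

lemma partialDeriv_mul {f g : Plane → ℂ} (hf : Differentiable ℝ f) (hg : Differentiable ℝ g)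
    (i : Fin 2) (x : Plane) :
    partialDeriv (fun y => f y * g y) i x
      = partialDeriv f i x * g x + f x * partialDeriv g i x := by
  simp only [partialDeriv, fderiv_fun_mul (hf x) (hg x)]
  simp
  ring

lemma partialDeriv_sub {f g : Plane → ℂ} (hf : Differentiable ℝ f) (hg : Differentiable ℝ g)
    (i : Fin 2) (x : Plane) :
    partialDeriv (fun y => f y - g y) i x = partialDeriv f i x - partialDeriv g i x := by
  simp only [partialDeriv, fderiv_fun_sub (hf x) (hg x)]
  simp

lemma partialDeriv_conj {f : Plane → ℂ} (hf : Differentiable ℝ f) (i : Fin 2) (x : Plane) :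
    partialDeriv (fun y => conj (f y)) i x = conj (partialDeriv f i x) := by
  have h := ((Complex.conjCLE : ℂ →L[ℝ] ℂ).hasFDerivAt (x := f x)).comp x (hf x).hasFDerivAt
  simp only [partialDeriv]
  erw [h.fderiv]
  simp

/-- Integration over the unit disk in polar coordinates. -/
lemma setIntegral_ball_eq_polar {g : Plane → ℂ} (hg : Continuous g) :
    ∫ x in Metric.ball (0 : Plane) 1, g x
      = ∫ r in (0:ℝ)..1, ∫ φ in (-π)..π, (r : ℂ) * g (r • gam φ) := by
  have hmp := (EuclideanSpace.volume_preserving_symm_measurableEquiv_toLp (Fin 2)).symm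
  have hmp2 := (volume_preserving_finTwoArrow ℝ).symm
  have hG : Continuous fun p : ℝ × ℝ => (p.1 : ℂ) * g (p.1 • gam p.2) := by
    have := (contDiff_gam (n := 0)).continuous
    fun_prop
  rw [← integral_indicator Metric.isOpen_ball.measurableSet, ← hmp.integral_comp',
    ← hmp2.integral_comp', ← integral_comp_polarCoord_symm]
  have hkey : ∀ p ∈ polarCoord.target, p.1 • (Metric.ball (0 : Plane) 1).indicator g
      ((MeasurableEquiv.toLp 2 (Fin 2 → ℝ)).symm.symm
        (MeasurableEquiv.finTwoArrow.symm (polarCoord.symm p)))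
      = (Set.Iio 1 ×ˢ Set.univ).indicator (fun p : ℝ × ℝ => (p.1 : ℂ) * g (p.1 • gam p.2)) p := by
    rintro ⟨r, φ⟩ ⟨hr, -⟩
    have hr : 0 < r := hr
    have hpt : ((MeasurableEquiv.toLp 2 (Fin 2 → ℝ)).symm.symm
        (MeasurableEquiv.finTwoArrow.symm (polarCoord.symm (r, φ)))) = r • gam φ := by
      ext i
      fin_cases i <;> simp [gam]
    have hn : ‖r • gam φ‖ = r := by
      rw [smul_gam, EuclideanSpace.norm_eq]
      simp only [Fin.sum_univ_two]
      simp [mul_pow, ← mul_add, abs_of_pos hr, Real.sqrt_sq hr.le]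
    rw [hpt]
    by_cases h1 : r < 1
    · rw [Set.indicator_of_mem (by simpa [hn] using h1), Set.indicator_of_mem (by simpa using h1)]
      simp
    · rw [Set.indicator_of_notMem (by simpa [hn] using h1),
        Set.indicator_of_notMem (by simpa using h1)]
      simp
  rw [setIntegral_congr_fun (polarCoord.open_target.measurableSet) hkey,
    setIntegral_indicator (measurableSet_Iio.prod MeasurableSet.univ), polarCoord_target,
    Set.prod_inter_prod, Set.inter_univ, Set.Ioi_inter_Iio, Measure.volume_eq_prod,
    setIntegral_prod]
  · rw [intervalIntegral.integral_of_le zero_le_one, integral_Ioc_eq_integral_Ioo]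
    refine setIntegral_congr_fun measurableSet_Ioo fun r _ => ?_
    simp only
    rw [intervalIntegral.integral_of_le (by linarith [Real.pi_pos]), integral_Ioc_eq_integral_Ioo]
  · exact (hG.continuousOn.integrableOn_compact (isCompact_Icc.prod isCompact_Icc)).mono_set
      (Set.prod_mono Set.Ioo_subset_Icc_self Set.Ioo_subset_Icc_self)

/-- The divergence theorem on the unit disk. -/
lemma setIntegral_ball_divergence {P Q : Plane → ℂ} (hP : ContDiff ℝ 1 P) (hQ : ContDiff ℝ 1 Q) :
    ∫ x in Metric.ball (0 : Plane) 1, (partialDeriv P 0 x + partialDeriv Q 1 x)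
      = ∫ φ in (0:ℝ)..(2 * π), (Real.cos φ * P (gam φ) + Real.sin φ * Q (gam φ)) := by
  have hPd := hP.differentiable one_ne_zero
  have hQd := hQ.differentiable one_ne_zero
  have hdiv : Continuous fun x => partialDeriv P 0 x + partialDeriv Q 1 x :=
    (contDiff_partialDeriv (m := 0) hP (by simp) 0).continuous.add
      (contDiff_partialDeriv (m := 0) hQ (by simp) 1).continuous
  have hgam : Continuous gam := (contDiff_gam (n := 0)).continuous
  have hcos : ContDiff ℝ 1 fun p : ℝ × ℝ => ((Real.cos p.2 : ℝ) : ℂ) :=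
    Complex.ofRealCLM.contDiff.comp (Real.contDiff_cos.comp contDiff_snd)
  have hsin : ContDiff ℝ 1 fun p : ℝ × ℝ => ((Real.sin p.2 : ℝ) : ℂ) :=
    Complex.ofRealCLM.contDiff.comp (Real.contDiff_sin.comp contDiff_snd)
  have hrad : ContDiff ℝ 1 fun p : ℝ × ℝ => ((p.1 : ℝ) : ℂ) :=
    Complex.ofRealCLM.contDiff.comp contDiff_fst
  have hpt : ContDiff ℝ 1 fun p : ℝ × ℝ => p.1 • gam p.2 :=
    contDiff_fst.smul (contDiff_gam.comp contDiff_snd)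
  set F : ℝ × ℝ → ℂ := fun p => p.1 * (Real.cos p.2 * P (p.1 • gam p.2)
    + Real.sin p.2 * Q (p.1 • gam p.2)) with hF_def
  set G : ℝ × ℝ → ℂ := fun p => -Real.sin p.2 * P (p.1 • gam p.2)
    + Real.cos p.2 * Q (p.1 • gam p.2) with hG_def
  have hF : ContDiff ℝ 1 F :=
    hrad.mul ((hcos.mul (hP.comp hpt)).add (hsin.mul (hQ.comp hpt)))
  have hG : ContDiff ℝ 1 G := (hsin.neg.mul (hP.comp hpt)).add (hcos.mul (hQ.comp hpt))
  have hFd := hF.differentiable one_ne_zero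
  have hGd := hG.differentiable one_ne_zero
  have hpolar : ∀ r φ : ℝ, fderiv ℝ F (r, φ) (1, 0) + fderiv ℝ G (r, φ) (0, 1)
      = r * (partialDeriv P 0 (r • gam φ) + partialDeriv Q 1 (r • gam φ)) := by
    intro r φ
    have h1 : HasDerivAt (fun s => F (s, φ)) (fderiv ℝ F (r, φ) (1, 0)) r :=
      (hFd (r, φ)).hasFDerivAt.comp_hasDerivAt (f := fun s => (s, φ)) r
        ((hasDerivAt_id r).prodMk (hasDerivAt_const r φ))
    have h2 : HasDerivAt (fun θ => G (r, θ)) (fderiv ℝ G (r, φ) (0, 1)) φ :=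
      (hGd (r, φ)).hasFDerivAt.comp_hasDerivAt (f := fun θ => (r, θ)) φ
        ((hasDerivAt_const φ r).prodMk (hasDerivAt_id φ))
    have h1' := (hasDerivAt_id r).ofReal_comp.mul
      (((hasDerivAt_radial hPd r φ).const_mul (Real.cos φ : ℂ)).add
        ((hasDerivAt_radial hQd r φ).const_mul (Real.sin φ : ℂ)))
    have h2' := ((Real.hasDerivAt_sin φ).ofReal_comp.neg.mul (hasDerivAt_angular hPd r φ)).add
      ((Real.hasDerivAt_cos φ).ofReal_comp.mul (hasDerivAt_angular hQd r φ))
    rw [h1.unique h1', h2.unique h2']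
    have hcs : (Real.sin φ : ℂ) ^ 2 + (Real.cos φ : ℂ) ^ 2 = 1 := by
      exact_mod_cast Real.sin_sq_add_cos_sq φ
    simp only [Pi.add_apply, Pi.neg_apply, id, Complex.ofReal_neg, Complex.ofReal_one]
    linear_combination (r : ℂ) * (partialDeriv P 0 (r • gam φ) + partialDeriv Q 1 (r • gam φ)) * hcs
  have hdivthm := integral2_divergence_prod_of_hasFDerivAt F G (fderiv ℝ F) (fderiv ℝ G)
    0 (-π) 1 π hF.continuous.continuousOn hG.continuous.continuousOn
    (fun x _ => (hFd x).hasFDerivAt) (fun x _ => (hGd x).hasFDerivAt)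
    ((((hF.continuous_fderiv one_ne_zero).clm_apply continuous_const).add
      ((hG.continuous_fderiv one_ne_zero).clm_apply
        continuous_const)).continuousOn.integrableOn_compact (isCompact_uIcc.prod isCompact_uIcc))
  simp only [hpolar] at hdivthm
  have hGper : ∀ r, G (r, π) = G (r, -π) := fun r => by
    have : gam π = gam (-π) := by
      rw [← gam_periodic (-π)]
      congr 1
      ring
    simp [hG_def, this]
  rw [setIntegral_ball_eq_polar hdiv, hdivthm]
  simp only [hGper, sub_self, zero_add]
  have hper : Function.Periodic
      (fun φ : ℝ => (Real.cos φ : ℂ) * P (gam φ) + Real.sin φ * Q (gam φ)) (2 * π) := fun φ => by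
    simp only [gam_periodic φ, Real.cos_periodic φ, Real.sin_periodic φ]
  have hshift := hper.intervalIntegral_add_eq (-π) 0
  rw [show -π + 2 * π = π by ring, zero_add] at hshift
  rw [← hshift]
  simp [hF_def]

lemma nder_eq {f : Plane → ℂ} (hf : Differentiable ℝ f) (φ : ℝ) :
    nder f φ
      = -(Real.cos φ * partialDeriv f 0 (gam φ) + Real.sin φ * partialDeriv f 1 (gam φ)) := by
  simp only [nder, (hasDerivAt_radial hf 1 φ).deriv, one_smul]

/-- Green's second identity on the unit disk. -/
lemma setIntegral_ball_green {u v : Plane → ℂ} (hu : ContDiff ℝ 2 u) (hv : ContDiff ℝ 2 v) :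
    (∫ x in Metric.ball (0 : Plane) 1, lap u x * conj (v x))
      - ∫ x in Metric.ball (0 : Plane) 1, u x * conj (lap v x)
      = ∫ φ in (0:ℝ)..(2 * π), (u (gam φ) * conj (nder v φ) - nder u φ * conj (v (gam φ))) := by
  have hu1 := fun i => contDiff_partialDeriv (m := 1) hu (by norm_num) i
  have hv1 := fun i => contDiff_partialDeriv (m := 1) hv (by norm_num) i
  have hu2 := fun i j => (contDiff_partialDeriv (m := 0) (hu1 i) (by norm_num) j).continuous
  have hv2 := fun i j => (contDiff_partialDeriv (m := 0) (hv1 i) (by norm_num) j).continuous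
  have hud := hu.differentiable two_ne_zero
  have hvd := hv.differentiable two_ne_zero
  have hu1d := fun i => (hu1 i).differentiable one_ne_zero
  have hv1d := fun i => (hv1 i).differentiable one_ne_zero
  have hconj : ∀ {f : Plane → ℂ} {n : WithTop ℕ∞}, ContDiff ℝ n f →
      ContDiff ℝ n fun x => conj (f x) := fun hf =>
    (Complex.conjCLE : ℂ →L[ℝ] ℂ).contDiff.comp hf
  have hcv := (hconj hv).differentiable two_ne_zero
  have hcv1 := fun i => (hconj (hv1 i)).differentiable one_ne_zero
  have hlapu : Continuous (lap u) := by
    rw [funext (lap_eq_partialDeriv u)]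
    exact (hu2 0 0).add (hu2 1 1)
  have hlapv : Continuous (lap v) := by
    rw [funext (lap_eq_partialDeriv v)]
    exact (hv2 0 0).add (hv2 1 1)
  have hclapv : Continuous fun x => conj (lap v x) := Complex.continuous_conj.comp hlapv
  have hint : ∀ {f : Plane → ℂ}, Continuous f → IntegrableOn f (Metric.ball (0 : Plane) 1) :=
    fun hf => (hf.continuousOn.integrableOn_compact (isCompact_closedBall 0 1)).mono_set
      Metric.ball_subset_closedBall
  have hW : ∀ i, ContDiff ℝ 1 fun x => partialDeriv u i x * conj (v x)
      - u x * conj (partialDeriv v i x) := fun i =>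
    ((hu1 i).mul (hconj (hv.of_le one_le_two))).sub
      ((hu.of_le one_le_two).mul (hconj (hv1 i)))
  rw [← integral_sub (hint (hlapu.fun_mul (hconj hv).continuous))
    (hint (hu.continuous.fun_mul hclapv))]
  calc _ = _ := integral_congr_ae (.of_forall fun x => ?_)
    _ = _ := setIntegral_ball_divergence (hW 0) (hW 1)
    _ = _ := intervalIntegral.integral_congr fun φ _ => ?_
  · rw [partialDeriv_sub ((hu1d 0).fun_mul hcv) (hud.fun_mul (hcv1 0)),
      partialDeriv_sub ((hu1d 1).fun_mul hcv) (hud.fun_mul (hcv1 1)),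
      partialDeriv_mul (hu1d 0) hcv, partialDeriv_mul (hu1d 1) hcv,
      partialDeriv_mul hud (hcv1 0), partialDeriv_mul hud (hcv1 1),
      partialDeriv_conj hvd, partialDeriv_conj hvd, partialDeriv_conj (hv1d 0),
      partialDeriv_conj (hv1d 1), lap_eq_partialDeriv, lap_eq_partialDeriv, map_add]
    ring
  · simp only [nder_eq hud, nder_eq hvd, map_neg, map_add, map_mul, Complex.conj_ofReal]
    ring

lemma nder2_eq {f : Plane → ℂ} (hf : ContDiff ℝ 2 f) (φ : ℝ) :
    nder2 f φ = Real.cos φ * (Real.cos φ * partialDeriv (partialDeriv f 0) 0 (gam φ)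
        + Real.sin φ * partialDeriv (partialDeriv f 0) 1 (gam φ))
      + Real.sin φ * (Real.cos φ * partialDeriv (partialDeriv f 1) 0 (gam φ)
        + Real.sin φ * partialDeriv (partialDeriv f 1) 1 (gam φ)) := by
  have hf1 := fun i => (contDiff_partialDeriv (m := 1) hf (by norm_num) i).differentiable
    one_ne_zero
  have h : deriv (fun r : ℝ => f (r • gam φ)) = fun r : ℝ =>
      (Real.cos φ : ℂ) * partialDeriv f 0 (r • gam φ)
        + (Real.sin φ : ℂ) * partialDeriv f 1 (r • gam φ) :=
    funext fun r => (hasDerivAt_radial (hf.differentiable two_ne_zero) r φ).deriv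
  rw [nder2, h, (((hasDerivAt_radial (hf1 0) 1 φ).const_mul (Real.cos φ : ℂ)).fun_add
    ((hasDerivAt_radial (hf1 1) 1 φ).const_mul (Real.sin φ : ℂ))).deriv]
  simp only [one_smul]

/-- The derivative of `f ∘ γ`, i.e. the tangential derivative of `f` on the unit circle. -/
def tder (f : Plane → ℂ) (φ : ℝ) : ℂ :=
  -Real.sin φ * partialDeriv f 0 (gam φ) + Real.cos φ * partialDeriv f 1 (gam φ)

lemma hasDerivAt_comp_gam {f : Plane → ℂ} (hf : Differentiable ℝ f) (φ : ℝ) :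
    HasDerivAt (fun θ => f (gam θ)) (tder f φ) φ := by
  simpa [tder] using hasDerivAt_angular hf 1 φ

/-- The polar form of the Laplacian on the unit circle. -/
lemma hasDerivAt_tder {f : Plane → ℂ} (hf : ContDiff ℝ 2 f) (φ : ℝ) :
    HasDerivAt (tder f) (lap f (gam φ) - nder2 f φ + nder f φ) φ := by
  have hf1 := fun i => (contDiff_partialDeriv (m := 1) hf (by norm_num) i).differentiable
    one_ne_zero
  refine (((Real.hasDerivAt_sin φ).ofReal_comp.fun_neg.fun_mul
    (hasDerivAt_comp_gam (hf1 0) φ)).fun_add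
    ((Real.hasDerivAt_cos φ).ofReal_comp.fun_mul (hasDerivAt_comp_gam (hf1 1) φ))).congr_deriv ?_
  have hcs : (Real.sin φ : ℂ) ^ 2 + (Real.cos φ : ℂ) ^ 2 = 1 := by
    exact_mod_cast Real.sin_sq_add_cos_sq φ
  rw [lap_eq_partialDeriv, nder2_eq hf, nder_eq (hf.differentiable two_ne_zero), tder, tder]
  simp only [Complex.ofReal_neg]
  linear_combination (partialDeriv (partialDeriv f 0) 0 (gam φ)
    + partialDeriv (partialDeriv f 1) 1 (gam φ)) * hcs

lemma tder_periodic (f : Plane → ℂ) : Function.Periodic (tder f) (2 * π) := fun φ => by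
  simp only [tder, gam_periodic φ, Real.cos_periodic φ, Real.sin_periodic φ]

/-- **Special Green formula** for the problem `Δu = f` in the unit disk,
`∂ν²u = g` on the unit circle. -/
theorem special_green_formula (u v : Plane → ℂ)
    (hu : ContDiff ℝ (⊤ : ℕ∞) u) (hv : ContDiff ℝ (⊤ : ℕ∞) v)
    (w h : ℝ → ℂ) (hw : ContDiff ℝ (⊤ : ℕ∞) w) (hh : ContDiff ℝ (⊤ : ℕ∞) h)
    (hwper : Function.Periodic w (2 * π)) (hhper : Function.Periodic h (2 * π)) :
    (∫ x in Metric.ball (0 : Plane) 1, lap u x * conj (v x)) +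
      (∫ φ in (0:ℝ)..(2 * π), lap u (gam φ) * conj (w φ)) +
      (∫ φ in (0:ℝ)..(2 * π), nder2 u φ * conj (h φ)) =
    (∫ x in Metric.ball (0 : Plane) 1, u x * conj (lap v x)) +
      (∫ φ in (0:ℝ)..(2 * π), u (gam φ) * conj (nder v φ + deriv (deriv w) φ)) +
      (∫ φ in (0:ℝ)..(2 * π), nder u φ * conj (-v (gam φ) - w φ)) +
      (∫ φ in (0:ℝ)..(2 * π), nder2 u φ * conj (w φ + h φ)) := by
  have hu2 : ContDiff ℝ 2 u := contDiff_infty.1 hu 2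
  have hv2 : ContDiff ℝ 2 v := contDiff_infty.1 hv 2
  have hw2 : ContDiff ℝ 2 w := contDiff_infty.1 hw 2
  have hud := hu2.differentiable two_ne_zero
  have hvd := hv2.differentiable two_ne_zero
  have hw1 : ContDiff ℝ 1 (deriv w) := ((contDiff_succ_iff_deriv (n := 1)).1 hw2).2.2
  have hpd : ∀ {f : Plane → ℂ}, ContDiff ℝ 2 f → ∀ i, Continuous (partialDeriv f i) :=
    fun hf i => (contDiff_partialDeriv (m := 1) hf (by norm_num) i).continuous
  have hpd2 : ∀ i j, Continuous (partialDeriv (partialDeriv u i) j) := fun i j =>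
    (contDiff_partialDeriv (m := 0) (contDiff_partialDeriv (m := 1) hu2 (by norm_num) i)
      (by norm_num) j).continuous
  have hgam : Continuous gam := (contDiff_gam (n := 0)).continuous
  have hnder : ∀ {f : Plane → ℂ}, ContDiff ℝ 2 f → Continuous (nder f) := fun hf => by
    rw [funext (nder_eq (hf.differentiable two_ne_zero))]
    have := hpd hf
    fun_prop
  have c_nu := hnder hu2
  have c_nv := hnder hv2
  have c_n2 : Continuous (nder2 u) := by
    rw [funext (nder2_eq hu2)]
    fun_prop
  have c_lap : Continuous fun φ => lap u (gam φ) := by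
    simp only [lap_eq_partialDeriv]
    fun_prop
  have c_u : Continuous fun φ => u (gam φ) := hu.continuous.comp hgam
  have c_v : Continuous fun φ => v (gam φ) := hv.continuous.comp hgam
  have c_w : Continuous w := hw.continuous
  have c_h : Continuous h := hh.continuous
  have c_w2 : Continuous (deriv (deriv w)) := hw1.continuous_deriv_one
  have hI : ∀ {f : ℝ → ℂ}, Continuous f → IntervalIntegrable f volume 0 (2 * π) :=
    fun hf => hf.intervalIntegrable _ _
  have c_conj := Complex.continuous_conj
  have hconj : ∀ {f : ℝ → ℂ} {f' : ℂ} {φ : ℝ}, HasDerivAt f f' φ →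
      HasDerivAt (fun θ => conj (f θ)) (conj f') φ := fun hf =>
    (Complex.conjCLE : ℂ →L[ℝ] ℂ).hasFDerivAt.comp_hasDerivAt _ hf
  have hwd : ∀ φ, HasDerivAt w (deriv w φ) φ := fun φ =>
    (hw2.differentiable two_ne_zero φ).hasDerivAt
  have hw1d : ∀ φ, HasDerivAt (deriv w) (deriv (deriv w) φ) φ := fun φ =>
    (hw1.differentiable one_ne_zero φ).hasDerivAt
  have hdwper : deriv w (2 * π) = deriv w 0 := by
    have := deriv_comp_add_const w (2 * π) 0
    rw [zero_add, show (fun x => w (x + 2 * π)) = w from funext hwper] at this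
    exact this.symm
  have hg0 : gam (2 * π) = gam 0 := by simpa using gam_periodic 0
  have hw0 : w (2 * π) = w 0 := by simpa using hwper 0
  have ht0 : tder u (2 * π) = tder u 0 := by simpa using tder_periodic u 0
  have hparts : ∫ φ in (0:ℝ)..(2 * π), ((lap u (gam φ) - nder2 u φ + nder u φ) * conj (w φ)
      - u (gam φ) * conj (deriv (deriv w) φ)) = 0 := by
    rw [intervalIntegral.integral_eq_sub_of_hasDerivAt
      (f := fun φ => tder u φ * conj (w φ) - u (gam φ) * conj (deriv w φ))]
    · simp [hg0, hw0, ht0, hdwper]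
    · intro φ _
      refine (((hasDerivAt_tder hu2 φ).fun_mul (hconj (hwd φ))).fun_sub
        ((hasDerivAt_comp_gam hud φ).fun_mul (hconj (hw1d φ)))).congr_deriv ?_
      ring
    · exact hI (by fun_prop)
  have hgreen := setIntegral_ball_green hu2 hv2
  rw [sub_eq_iff_eq_add] at hgreen
  rw [hgreen, ← sub_eq_zero, ← hparts]
  have e1 : Continuous fun φ => u (gam φ) * conj (nder v φ) - nder u φ * conj (v (gam φ)) := by
    fun_prop
  have e2 : Continuous fun φ => lap u (gam φ) * conj (w φ) := by fun_prop
  have e3 : Continuous fun φ => nder2 u φ * conj (h φ) := by fun_prop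
  have e4 : Continuous fun φ => u (gam φ) * conj (nder v φ + deriv (deriv w) φ) := by fun_prop
  have e5 : Continuous fun φ => nder u φ * conj (-v (gam φ) - w φ) := by fun_prop
  have e6 : Continuous fun φ => nder2 u φ * conj (w φ + h φ) := by fun_prop
  have hsum : (∫ φ in (0:ℝ)..(2 * π), ((lap u (gam φ) - nder2 u φ + nder u φ) * conj (w φ)
      - u (gam φ) * conj (deriv (deriv w) φ)))
      = ((∫ φ in (0:ℝ)..(2 * π), (u (gam φ) * conj (nder v φ) - nder u φ * conj (v (gam φ))))
        + (∫ φ in (0:ℝ)..(2 * π), lap u (gam φ) * conj (w φ))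
        + ∫ φ in (0:ℝ)..(2 * π), nder2 u φ * conj (h φ))
      - ((∫ φ in (0:ℝ)..(2 * π), u (gam φ) * conj (nder v φ + deriv (deriv w) φ))
        + (∫ φ in (0:ℝ)..(2 * π), nder u φ * conj (-v (gam φ) - w φ))
        + ∫ φ in (0:ℝ)..(2 * π), nder2 u φ * conj (w φ + h φ)) := by
    rw [← intervalIntegral.integral_add (hI e1) (hI e2),
      ← intervalIntegral.integral_add (hI (e1.fun_add e2)) (hI e3),
      ← intervalIntegral.integral_add (hI e4) (hI e5),
      ← intervalIntegral.integral_add (hI (e4.fun_add e5)) (hI e6),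
      ← intervalIntegral.integral_sub (hI ((e1.fun_add e2).fun_add e3))
        (hI ((e4.fun_add e5).fun_add e6))]
    refine intervalIntegral.integral_congr fun φ _ => ?_
    simp only [map_add, map_sub, map_neg]
    ring
  rw [hsum]
  ring
end
end
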